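/- (Optimality certificate for a Walrasian equilibrium, key step of Lemma 2.) For each user u let X_u be a nonempty finite set of request schemes θ_u; for each BS n let X_n be a nonempty finite set of triples (φ_n, ε_n, ρ_n); for each MBS m let X_m be a nonempty finite set of allocation schemes δ_m; and let X_S be a nonempty finite set of satellite allocation schemes β. Suppose there exist dual variables λ*, ς*, ξ* and schemes θ*, φ*, ε*, ρ*, δ*, β* such that: (i) for every u, θ*_u maximizes L_u(·, λ*) over X_u; (ii) for every n, (φ*_n, ε*_n, ρ*_n) maximizes L_n(·, λ*, ς*, ξ*) over X_n; (iii) for every m, δ*_m maximizes L_m(·, ς*) over X_m; (iv) β* maximizes L_S(·, ξ*) over X_S; and (v) the market clearance conditions ρ* = θ*, δ* = φ*, β* = ε* hold componentwise. Then the tuple (θ*, φ*, ε*, ρ*, δ*, β*) maximizes the price-free total payoff J̃ among all tuples with θ_u ∈ X_u, (φ_n, ε_n, ρ_n) ∈ X_n, δ_m ∈ X_m, β ∈ X_S that satisfy the market clearance conditions ρ = θ, δ = φ, β = ε. -/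

import Mathlib

open scoped BigOperators

/-- Price-free total payoff `J̃` of the ISDN market. -/
noncomputable def Jtilde (U N M T : ℕ)
    (cB : Fin N → Fin U → Fin T → ℝ → ℝ)
    (cM : Fin N → Fin M → Fin T → ℝ → ℝ)
    (cS : Fin N → Fin T → ℝ → ℝ)
    (Piu : Fin U → ℝ) (Pin : Fin N → ℝ)
    (θ ρ : Fin N → Fin U → Fin T → ℝ)
    (φ δ : Fin N → Fin M → Fin T → ℝ)
    (ε β : Fin N → Fin T → ℝ) : ℝ :=
  (1 / (T : ℝ)) *
    (∑ u, (1 / Piu u) * ∑ n, ∑ t, cB n u t (θ n u t)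
      - ∑ n, ∑ u, ∑ t, ρ n u t
      + ∑ n, (1 / Pin n) *
          (∑ m, ∑ t, cM n m t (φ n m t) + ∑ t, cS n t (ε n t))
      - ∑ n, ∑ m, ∑ t, δ n m t
      - ∑ n, ∑ t, β n t)

/-- Local Lagrangian `L_u(θ_u, λ)` at user `u`. -/
noncomputable def Lu (U N T : ℕ)
    (cB : Fin N → Fin U → Fin T → ℝ → ℝ) (Piu : Fin U → ℝ)
    (lam : Fin N → Fin U → Fin T → ℝ) (u : Fin U)
    (θu : Fin N → Fin T → ℝ) : ℝ :=
  (1 / ((T : ℝ) * Piu u)) * ∑ n, ∑ t, cB n u t (θu n t)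
    - ∑ n, ∑ t, lam n u t * θu n t

/-- Local Lagrangian `L_n(φ_n, ε_n, ρ_n, λ, ς, ξ)` at BS `n`; the triple `p`
is `(φ_n, ε_n, ρ_n)`. -/
noncomputable def Ln (U N M T : ℕ)
    (cM : Fin N → Fin M → Fin T → ℝ → ℝ) (cS : Fin N → Fin T → ℝ → ℝ)
    (Pin : Fin N → ℝ)
    (lam : Fin N → Fin U → Fin T → ℝ)
    (ς : Fin N → Fin M → Fin T → ℝ)
    (ξ : Fin N → Fin T → ℝ) (n : Fin N)
    (p : (Fin M → Fin T → ℝ) × (Fin T → ℝ) × (Fin U → Fin T → ℝ)) : ℝ :=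
  (1 / ((T : ℝ) * Pin n)) *
      (∑ m, ∑ t, cM n m t (p.1 m t) + ∑ t, cS n t (p.2.1 t))
    - ∑ m, ∑ t, ς n m t * p.1 m t
    - ∑ t, ξ n t * p.2.1 t
    + ∑ u, ∑ t, lam n u t * p.2.2 u t
    - (1 / (T : ℝ)) * ∑ u, ∑ t, p.2.2 u t

/-- Local Lagrangian `L_m(δ_m, ς)` at MBS `m`. -/
noncomputable def Lm (N M T : ℕ)
    (ς : Fin N → Fin M → Fin T → ℝ) (m : Fin M)
    (δm : Fin N → Fin T → ℝ) : ℝ :=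
  ∑ n, ∑ t, ς n m t * δm n t - (1 / (T : ℝ)) * ∑ n, ∑ t, δm n t

/-- Local Lagrangian `L_S(β, ξ)` at the satellite. -/
noncomputable def LS (N T : ℕ)
    (ξ : Fin N → Fin T → ℝ) (β : Fin N → Fin T → ℝ) : ℝ :=
  ∑ n, ∑ t, ξ n t * β n t - (1 / (T : ℝ)) * ∑ n, ∑ t, β n t

/-- Under market clearance the price terms cancel, so the price-free total payoff is the sum of
all local Lagrangians, whatever the dual variables. -/
lemma Jtilde_eq_sum_lagrangians (U N M T : ℕ)
    (cB : Fin N → Fin U → Fin T → ℝ → ℝ)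
    (cM : Fin N → Fin M → Fin T → ℝ → ℝ)
    (cS : Fin N → Fin T → ℝ → ℝ)
    (Piu : Fin U → ℝ) (Pin : Fin N → ℝ)
    (lam : Fin N → Fin U → Fin T → ℝ)
    (ς : Fin N → Fin M → Fin T → ℝ)
    (ξ : Fin N → Fin T → ℝ)
    (θ : Fin N → Fin U → Fin T → ℝ)
    (φ : Fin N → Fin M → Fin T → ℝ)
    (ε : Fin N → Fin T → ℝ) :
    Jtilde U N M T cB cM cS Piu Pin θ θ φ φ ε ε =
      ∑ u, Lu U N T cB Piu lam u (fun n t => θ n u t)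
        + ∑ n, Ln U N M T cM cS Pin lam ς ξ n
            ((fun m t => φ n m t), (fun t => ε n t), (fun u t => θ n u t))
        + ∑ m, Lm N M T ς m (fun n t => φ n m t)
        + LS N T ξ ε := by
  have hlam : ∑ u, ∑ n, ∑ t, lam n u t * θ n u t = ∑ n, ∑ u, ∑ t, lam n u t * θ n u t :=
    Finset.sum_comm
  have hς : ∑ m, ∑ n, ∑ t, ς n m t * φ n m t = ∑ n, ∑ m, ∑ t, ς n m t * φ n m t :=
    Finset.sum_comm
  have hφ : ∑ m, ∑ n, ∑ t, φ n m t = ∑ n, ∑ m, ∑ t, φ n m t := Finset.sum_comm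
  simp only [Jtilde, Lu, Ln, Lm, LS, one_div, mul_inv, mul_assoc, Finset.sum_add_distrib,
    Finset.sum_sub_distrib, ← Finset.mul_sum, hlam, hς, hφ]
  ring

/-- key step of Lemma 2: if, at duals `λ*, ς*, ξ*`, every local
Lagrangian is maximized by the corresponding component of a tuple of schemes
that satisfies the market clearance conditions, then this tuple maximizes the
price-free total payoff `J̃` among all clearance-feasible tuples. -/
theorem walrasian_equilibrium_optimality
    (U N M T : ℕ) (hT : 0 < T)
    (cB : Fin N → Fin U → Fin T → ℝ → ℝ)
    (cM : Fin N → Fin M → Fin T → ℝ → ℝ)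
    (cS : Fin N → Fin T → ℝ → ℝ)
    (Piu : Fin U → ℝ) (Pin : Fin N → ℝ)
    (hPiu : ∀ u, Piu u ≠ 0) (hPin : ∀ n, Pin n ≠ 0)
    (Xu : Fin U → Set (Fin N → Fin T → ℝ))
    (hXufin : ∀ u, (Xu u).Finite) (hXune : ∀ u, (Xu u).Nonempty)
    (Xn : Fin N → Set ((Fin M → Fin T → ℝ) × (Fin T → ℝ) × (Fin U → Fin T → ℝ)))
    (hXnfin : ∀ n, (Xn n).Finite) (hXnne : ∀ n, (Xn n).Nonempty)
    (Xm : Fin M → Set (Fin N → Fin T → ℝ))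
    (hXmfin : ∀ m, (Xm m).Finite) (hXmne : ∀ m, (Xm m).Nonempty)
    (XS : Set (Fin N → Fin T → ℝ))
    (hXSfin : XS.Finite) (hXSne : XS.Nonempty)
    (lam : Fin N → Fin U → Fin T → ℝ)
    (ς : Fin N → Fin M → Fin T → ℝ)
    (ξ : Fin N → Fin T → ℝ)
    (θs ρs : Fin N → Fin U → Fin T → ℝ)
    (φs δs : Fin N → Fin M → Fin T → ℝ)
    (εs βs : Fin N → Fin T → ℝ)
    -- (i) each θ*_u maximizes L_u(·, λ*) over X_u
    (hθs : ∀ u, (fun n t => θs n u t) ∈ Xu u)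
    (hθsmax : ∀ u, ∀ θu ∈ Xu u,
      Lu U N T cB Piu lam u θu ≤ Lu U N T cB Piu lam u (fun n t => θs n u t))
    -- (ii) each (φ*_n, ε*_n, ρ*_n) maximizes L_n(·, λ*, ς*, ξ*) over X_n
    (hns : ∀ n,
      ((fun m t => φs n m t), (fun t => εs n t), (fun u t => ρs n u t)) ∈ Xn n)
    (hnsmax : ∀ n, ∀ p ∈ Xn n,
      Ln U N M T cM cS Pin lam ς ξ n p ≤
        Ln U N M T cM cS Pin lam ς ξ n
          ((fun m t => φs n m t), (fun t => εs n t), (fun u t => ρs n u t)))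
    -- (iii) each δ*_m maximizes L_m(·, ς*) over X_m
    (hδs : ∀ m, (fun n t => δs n m t) ∈ Xm m)
    (hδsmax : ∀ m, ∀ δm ∈ Xm m,
      Lm N M T ς m δm ≤ Lm N M T ς m (fun n t => δs n m t))
    -- (iv) β* maximizes L_S(·, ξ*) over X_S
    (hβs : βs ∈ XS)
    (hβsmax : ∀ β ∈ XS, LS N T ξ β ≤ LS N T ξ βs)
    -- (v) market clearance at the starred tuple
    (hclear₁ : ρs = θs) (hclear₂ : δs = φs) (hclear₃ : βs = εs) :
    ∀ (θ ρ : Fin N → Fin U → Fin T → ℝ)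
      (φ δ : Fin N → Fin M → Fin T → ℝ)
      (ε β : Fin N → Fin T → ℝ),
      (∀ u, (fun n t => θ n u t) ∈ Xu u) →
      (∀ n, ((fun m t => φ n m t), (fun t => ε n t), (fun u t => ρ n u t)) ∈ Xn n) →
      (∀ m, (fun n t => δ n m t) ∈ Xm m) →
      β ∈ XS →
      ρ = θ → δ = φ → β = ε →
      Jtilde U N M T cB cM cS Piu Pin θ ρ φ δ ε β
        ≤ Jtilde U N M T cB cM cS Piu Pin θs ρs φs δs εs βs := by
  rintro θ _ φ _ ε _ hθ hn hδ hβ rfl rfl rfl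
  subst hclear₁ hclear₂ hclear₃
  rw [Jtilde_eq_sum_lagrangians U N M T cB cM cS Piu Pin lam ς ξ,
    Jtilde_eq_sum_lagrangians U N M T cB cM cS Piu Pin lam ς ξ]
  exact add_le_add (add_le_add (add_le_add
    (Finset.sum_le_sum fun u _ => hθsmax u _ (hθ u))
    (Finset.sum_le_sum fun n _ => hnsmax n _ (hn n)))
    (Finset.sum_le_sum fun m _ => hδsmax m _ (hδ m)))
    (hβsmax _ hβ)
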